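/- There is no truthful cake cutting mechanism that attains a utilitarian optimal allocation in every piecewise uniform cake cutting situation: for n = 3 agents, there is no function F mapping each triple (P_1, P_2, P_3) of piecewise uniform preference sets to an allocation, such that (a) for every triple of preferences, F outputs a utilitarian optimal allocation for those preferences, and (b) F is truthful, i.e. for every triple of true preferences (P_1,...,P_3), every agent i and every piecewise uniform misreport Q, the utility u_i (computed with respect to the true P_i) of agent i's portion in F(P_1,...,P_3) is at least the utility u_i of agent i's portion in F applied to the profile with P_i replaced by Q. -/

import Mathlib

open MeasureTheory

/-- An allocation: a tuple of pairwise disjoint measurable subsets of the cake `[0,1]`. -/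
def IsAllocation {n : ℕ} (A : Fin n → Set ℝ) : Prop :=
  (∀ i, A i ⊆ Set.Icc 0 1) ∧ (∀ i, MeasurableSet (A i)) ∧
    ∀ i j, i ≠ j → Disjoint (A i) (A j)

/-- A piecewise uniform preference set: a finite union of closed intervals inside `[0,1]`
with positive total length. -/
def PWUniform (P : Set ℝ) : Prop :=
  (∃ (m : ℕ) (a b : Fin m → ℝ), P = ⋃ k, Set.Icc (a k) (b k)) ∧
    P ⊆ Set.Icc 0 1 ∧ 0 < volume P

/-- Piecewise uniform utility: `u_P(X) = |X ∩ P| / |P|`. -/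
noncomputable def pwUtil (P X : Set ℝ) : ℝ :=
  (volume (X ∩ P)).toReal / (volume P).toReal

lemma pwUniform_Icc {a b : ℝ} (ha : 0 ≤ a) (hab : a < b) (hb : b ≤ 1) :
    PWUniform (Set.Icc a b) := by
  refine ⟨⟨1, fun _ => a, fun _ => b, by simp [Set.iUnion_const]⟩, Set.Icc_subset_Icc ha hb, ?_⟩
  simpa using hab

lemma pwUtil_Icc {a b : ℝ} (hab : a ≤ b) (X : Set ℝ) :
    pwUtil (Set.Icc a b) X = volume.real (X ∩ Set.Icc a b) / (b - a) := by
  rw [← Real.volume_real_Icc_of_le hab]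
  rfl

lemma measureReal_inter_add_inter_le {α : Type*} [MeasurableSpace α] {μ : Measure α}
    {A B S T U : Set α} (hAB : Disjoint A B) (hBT : MeasurableSet (B ∩ T))
    (hS : S ⊆ U) (hT : T ⊆ U) (hU : μ U ≠ ⊤) :
    μ.real (A ∩ S) + μ.real (B ∩ T) ≤ μ.real U := by
  have hA : A ∩ S ⊆ U := Set.inter_subset_right.trans hS
  have hB : B ∩ T ⊆ U := Set.inter_subset_right.trans hT
  rw [← measureReal_union (hAB.mono Set.inter_subset_left Set.inter_subset_left) hBT
    (measure_ne_top_of_subset hA hU) (measure_ne_top_of_subset hB hU)]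
  exact measureReal_mono (Set.union_subset hA hB) hU

lemma isAllocation_vecCons {X Y Z : Set ℝ} (hX : X ⊆ Set.Icc 0 1) (hY : Y ⊆ Set.Icc 0 1)
    (hZ : Z ⊆ Set.Icc 0 1) (mX : MeasurableSet X) (mY : MeasurableSet Y) (mZ : MeasurableSet Z)
    (hXY : Disjoint X Y) (hXZ : Disjoint X Z) (hYZ : Disjoint Y Z) :
    IsAllocation ![X, Y, Z] := by
  refine ⟨?_, ?_, ?_⟩
  · simp [Fin.forall_fin_succ, hX, hY, hZ]
  · simp [Fin.forall_fin_succ, mX, mY, mZ]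
  · simp [Fin.forall_fin_succ, hXY, hXZ, hYZ, hXY.symm, hXZ.symm, hYZ.symm]

/-- There is no truthful cake cutting mechanism that attains a utilitarian optimal
allocation in every piecewise uniform cake cutting situation with three agents. -/
theorem no_truthful_utilitarian_optimal_mechanism :
    ¬ ∃ F : (Fin 3 → Set ℝ) → (Fin 3 → Set ℝ),
      (∀ P : Fin 3 → Set ℝ, (∀ i, PWUniform (P i)) →
        IsAllocation (F P) ∧
        ∀ B : Fin 3 → Set ℝ, IsAllocation B →
          ∑ i, pwUtil (P i) (B i) ≤ ∑ i, pwUtil (P i) (F P i)) ∧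
      (∀ P : Fin 3 → Set ℝ, (∀ i, PWUniform (P i)) →
        ∀ (i : Fin 3) (Q : Set ℝ), PWUniform Q →
          pwUtil (P i) (F (Function.update P i Q) i) ≤ pwUtil (P i) (F P i)) := by
  rintro ⟨F, hopt, htruth⟩
  let P : Fin 3 → Set ℝ := ![Set.Icc 0 (3/5), Set.Icc 0 (9/10), Set.Icc (9/10) 1]
  let P' : Fin 3 → Set ℝ := ![Set.Icc 0 (3/5), Set.Icc 0 (1/2), Set.Icc (9/10) 1]
  have hQ : PWUniform (Set.Icc 0 (1/2)) := pwUniform_Icc (by norm_num) (by norm_num) (by norm_num)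
  have h0 : PWUniform (Set.Icc 0 (3/5)) := pwUniform_Icc (by norm_num) (by norm_num) (by norm_num)
  have h1 : PWUniform (Set.Icc 0 (9/10)) := pwUniform_Icc (by norm_num) (by norm_num) (by norm_num)
  have h2 : PWUniform (Set.Icc (9/10) 1) := pwUniform_Icc (by norm_num) (by norm_num) (by norm_num)
  have hP : ∀ i, PWUniform (P i) := by simp [P, Fin.forall_fin_succ, h0, h1, h2, -one_div]
  have hP' : ∀ i, PWUniform (P' i) := by simp [P', Fin.forall_fin_succ, h0, hQ, h2, -one_div]
  have hupd : Function.update P 1 (Set.Icc 0 (1/2)) = P' := by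
    ext i : 1
    fin_cases i <;> rfl
  have htr := htruth P hP 1 _ hQ
  rw [hupd] at htr
  obtain ⟨⟨-, hm, hd⟩, ho⟩ := hopt P hP
  obtain ⟨⟨-, hm', hd'⟩, ho'⟩ := hopt P' hP'
  have hB : IsAllocation ![Set.Icc (0 : ℝ) (3/5), Set.Ioc (3/5) (9/10), Set.Ioc (9/10) 1] := by
    refine isAllocation_vecCons ?_ ?_ ?_ measurableSet_Icc measurableSet_Ioc measurableSet_Ioc
      ?_ ?_ ?_
    iterate 3 exact fun x hx => ⟨by linarith [hx.1], by linarith [hx.2]⟩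
    all_goals exact Set.disjoint_left.2 fun x hx hy => by linarith [hx.2, hy.1]
  have hB' : IsAllocation ![Set.Ioc (1/2 : ℝ) (3/5), Set.Icc 0 (1/2), Set.Ioc (9/10) 1] := by
    refine isAllocation_vecCons ?_ ?_ ?_ measurableSet_Ioc measurableSet_Icc measurableSet_Ioc
      ?_ ?_ ?_
    iterate 3 exact fun x hx => ⟨by linarith [hx.1], by linarith [hx.2]⟩
    · exact Set.disjoint_left.2 fun x hx hy => by linarith [hx.1, hy.2]
    all_goals exact Set.disjoint_left.2 fun x hx hy => by linarith [hx.2, hy.1]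
  have key := ho _ hB
  have key' := ho' _ hB'
  have e0 (X) : pwUtil (Set.Icc 0 (3/5)) X = _ := pwUtil_Icc (by norm_num) X
  have e1 (X) : pwUtil (Set.Icc 0 (9/10)) X = _ := pwUtil_Icc (by norm_num) X
  have eQ (X) : pwUtil (Set.Icc 0 (1/2)) X = _ := pwUtil_Icc (by norm_num) X
  have e2 (X) : pwUtil (Set.Icc (9/10) 1) X = _ := pwUtil_Icc (by norm_num) X
  have i1 : Set.Ioc (3/5 : ℝ) (9/10) ∩ Set.Icc 0 (9/10) = Set.Ioc (3/5) (9/10) :=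
    Set.inter_eq_left.2 fun x hx => ⟨by linarith [hx.1], hx.2⟩
  have i2 : Set.Ioc (9/10 : ℝ) 1 ∩ Set.Icc (9/10) 1 = Set.Ioc (9/10) 1 :=
    Set.inter_eq_left.2 Set.Ioc_subset_Icc_self
  have i0 : Set.Ioc (1/2 : ℝ) (3/5) ∩ Set.Icc 0 (3/5) = Set.Ioc (1/2) (3/5) :=
    Set.inter_eq_left.2 fun x hx => ⟨by linarith [hx.1], hx.2⟩
  simp only [P, P', Fin.sum_univ_three, Matrix.cons_val, e0, e1, e2, eQ, i0, i1, i2,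
    Set.inter_self] at key key' htr
  rw [Real.volume_real_Icc_of_le (by norm_num), Real.volume_real_Ioc_of_le (by norm_num),
    Real.volume_real_Ioc_of_le (by norm_num)] at key key'
  have c := measureReal_inter_add_inter_le (μ := volume) (hd 0 1 (by decide))
    ((hm 1).inter measurableSet_Icc) (Set.Icc_subset_Icc_right (by norm_num : (3/5 : ℝ) ≤ 9/10))
    (subset_refl (Set.Icc (0 : ℝ) (9/10))) measure_Icc_lt_top.ne
  have c' := measureReal_inter_add_inter_le (μ := volume) (hd' 0 1 (by decide))
    ((hm' 1).inter measurableSet_Icc) (subset_refl (Set.Icc (0 : ℝ) (3/5)))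
    (Set.Icc_subset_Icc_right (by norm_num : (1/2 : ℝ) ≤ 3/5)) measure_Icc_lt_top.ne
  have third (X : Set ℝ) : volume.real (X ∩ Set.Icc (9/10) 1) ≤ volume.real (Set.Icc (9/10 : ℝ) 1) :=
    measureReal_mono Set.inter_subset_right measure_Icc_lt_top.ne
  have mono : volume.real (F P' 1 ∩ Set.Icc 0 (1/2)) ≤ volume.real (F P' 1 ∩ Set.Icc 0 (9/10)) :=
    measureReal_mono (Set.inter_subset_inter_right _ (Set.Icc_subset_Icc_right (by norm_num)))
      (measure_ne_top_of_subset Set.inter_subset_right measure_Icc_lt_top.ne)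
  have t := third (F P 2)
  have t' := third (F P' 2)
  rw [Real.volume_real_Icc_of_le (by norm_num)] at c c' t t'
  simp only [P, P'] at c c' t t' mono
  norm_num at key key' htr c c' t t' mono
  linarith
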